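/- A two-dimensional complex Finsler metric on D is a complex Landsberg metric if and only if F·A·(E−Y) = δ_k(A)·η^k − F·A·(J+Y) and F·B·(E−Y) = δ_k(B)·η^k − (F·B/2)·(J+Y) at every point of D. -/

import Mathlib

open Complex

noncomputable section

namespace CFinsler

/-- A point of `T'M` in local coordinates: `(z, η) ∈ ℂⁿ × ℂⁿ`. -/
abbrev Pt (n : ℕ) := (Fin n → ℂ) × (Fin n → ℂ)

variable {n : ℕ}

/-- Wirtinger derivative `∂f/∂z^k`. -/
def dz (f : Pt n → ℂ) (k : Fin n) (p : Pt n) : ℂ :=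
  (1 / 2) * (fderiv ℝ f p ((Pi.single k 1 : Fin n → ℂ), 0) -
    Complex.I * fderiv ℝ f p ((Pi.single k Complex.I : Fin n → ℂ), 0))

/-- Wirtinger derivative `∂f/∂z̄^k`. -/
def dzbar (f : Pt n → ℂ) (k : Fin n) (p : Pt n) : ℂ :=
  (1 / 2) * (fderiv ℝ f p ((Pi.single k 1 : Fin n → ℂ), 0) +
    Complex.I * fderiv ℝ f p ((Pi.single k Complex.I : Fin n → ℂ), 0))

/-- Wirtinger derivative `∂f/∂η^k`. -/
def de (f : Pt n → ℂ) (k : Fin n) (p : Pt n) : ℂ :=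
  (1 / 2) * (fderiv ℝ f p (0, (Pi.single k 1 : Fin n → ℂ)) -
    Complex.I * fderiv ℝ f p (0, (Pi.single k Complex.I : Fin n → ℂ)))

/-- Wirtinger derivative `∂f/∂η̄^k`. -/
def debar (f : Pt n → ℂ) (k : Fin n) (p : Pt n) : ℂ :=
  (1 / 2) * (fderiv ℝ f p (0, (Pi.single k 1 : Fin n → ℂ)) +
    Complex.I * fderiv ℝ f p (0, (Pi.single k Complex.I : Fin n → ℂ)))

/-- The fundamental metric tensor `g_{i j̄} := ∂²L/∂η^i ∂η̄^j`. -/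
def gm (L : Pt n → ℂ) (i j : Fin n) : Pt n → ℂ := de (debar L j) i

/-- `L` is an `n`-dimensional complex Finsler metric on `D`. -/
structure IsCFM (n : ℕ) (D : Set (Pt n)) (L : Pt n → ℂ) : Prop where
  openD : IsOpen D
  fiber_ne : ∀ p ∈ D, p.2 ≠ 0
  conic : ∀ p ∈ D, ∀ lam : ℂ, lam ≠ 0 → (p.1, lam • p.2) ∈ D
  smooth : ContDiffOn ℝ (⊤ : ℕ∞) L D
  real_im : ∀ p ∈ D, (L p).im = 0
  pos : ∀ p ∈ D, 0 < (L p).re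
  homog : ∀ p ∈ D, ∀ lam : ℂ, lam ≠ 0 →
    L (p.1, lam • p.2) = ((Complex.normSq lam : ℝ) : ℂ) * L p
  hermitian : ∀ p ∈ D, ∀ i j, (starRingEnd ℂ) (gm L i j p) = gm L j i p
  posdef : ∀ p ∈ D, ∀ v : Fin n → ℂ, v ≠ 0 →
    0 < (∑ i, ∑ j, gm L i j p * v i * (starRingEnd ℂ) (v j)).re

variable (L : Pt n → ℂ)

/-- The metric tensor as a matrix at a point. -/
def gmat (p : Pt n) : Matrix (Fin n) (Fin n) ℂ := fun i j => gm L i j p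

/-- The inverse metric tensor `g^{l̄ i}`. -/
def gi (l i : Fin n) (p : Pt n) : ℂ := (gmat L p)⁻¹ l i

/-- The Chern–Finsler nonlinear connection coefficients
`N^i_k := g^{m̄ i} (∂g_{l m̄}/∂z^k) η^l`. -/
def Nc (i k : Fin n) (p : Pt n) : ℂ :=
  ∑ m, ∑ l, gi L m i p * dz (gm L l m) k p * p.2 l

/-- The horizontal derivation `δ_k := ∂/∂z^k − N^j_k ∂/∂η^j`. -/
def del (f : Pt n → ℂ) (k : Fin n) (p : Pt n) : ℂ :=
  dz f k p - ∑ j, Nc L j k p * de f j p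

/-- The conjugate horizontal derivation `δ_k̄ := ∂/∂z̄^k − N̄^j_k ∂/∂η̄^j`. -/
def delbar (f : Pt n → ℂ) (k : Fin n) (p : Pt n) : ℂ :=
  dzbar f k p - ∑ j, (starRingEnd ℂ) (Nc L j k p) * debar f j p

/-- The horizontal Chern–Finsler connection coefficients `L^i_{jk} := g^{l̄ i} δ_k(g_{j l̄})`. -/
def Lc (i j k : Fin n) (p : Pt n) : ℂ := ∑ l, gi L l i p * del L (gm L j l) k p

/-- The vertical Chern–Finsler connection coefficients `C^i_{jk} := g^{l̄ i} ∂g_{j l̄}/∂η^k`. -/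
def Cc (i j k : Fin n) (p : Pt n) : ℂ := ∑ l, gi L l i p * de (gm L j l) k p

/-- The spray coefficients `G^i := ½ N^i_j η^j`. -/
def Gs (i : Fin n) (p : Pt n) : ℂ := (1 / 2) * ∑ j, Nc L i j p * p.2 j

/-- The canonical horizontal derivation `δ̊_k := ∂/∂z^k − (∂G^j/∂η^k) ∂/∂η^j`. -/
def delc (f : Pt n → ℂ) (k : Fin n) (p : Pt n) : ℂ :=
  dz f k p - ∑ j, de (Gs L j) k p * de f j p

/-- `F := √L`. -/
def Fh (p : Pt n) : ℂ := (Real.sqrt ((L p).re) : ℂ)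

/-- `l^i := η^i / F`. -/
def lup (i : Fin n) (p : Pt n) : ℂ := p.2 i / Fh L p

/-- `l_i := g_{i j̄} η̄^j / F`. -/
def llow (i : Fin n) (p : Pt n) : ℂ :=
  (∑ j, gm L i j p * (starRingEnd ℂ) (p.2 j)) / Fh L p

/-- `√g` where `g := det(g_{i j̄})`. -/
def sg (p : Pt n) : ℂ := (Real.sqrt ((gmat L p).det.re) : ℂ)

/-- The metric is Kähler. -/
def IsKahler (D : Set (Pt n)) : Prop := ∀ p ∈ D, ∀ i j k, Lc L i j k p = Lc L i k j p

/-- The metric is weakly Kähler. -/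
def IsWeaklyKahler (D : Set (Pt n)) : Prop :=
  ∀ p ∈ D, ∀ k, (∑ i, ∑ j, ∑ l, gm L i l p * (Lc L i j k p - Lc L i k j p) *
    p.2 j * (starRingEnd ℂ) (p.2 l)) = 0

/-- The metric is purely Hermitian: `g_{i j̄}` does not depend on the fibre variable. -/
def IsPurelyHermitian (D : Set (Pt n)) : Prop :=
  ∀ p ∈ D, ∀ i j k, de (gm L i j) k p = 0 ∧ debar (gm L i j) k p = 0

/-- The metric is a complex Berwald metric: Kähler with `L^i_{jk}` independent of the
fibre variable. -/
def IsBerwald (D : Set (Pt n)) : Prop :=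
  IsKahler L D ∧ ∀ p ∈ D, ∀ i j k l, de (Lc L i j k) l p = 0 ∧ debar (Lc L i j k) l p = 0

/-- The metric is a complex Landsberg metric: the Berwald and Rund connections coincide. -/
def IsLandsberg (D : Set (Pt n)) : Prop :=
  ∀ p ∈ D, ∀ i j k, de (de (Gs L i) k) j p =
    (1 / 2) * ∑ l, gi L l i p * (delc L (gm L j l) k p + delc L (gm L k l) j p)

/-- `m^i` of the local complex Berwald frame: `m¹ = −l₂/√g`, `m² = l₁/√g`. -/
def mup (L : Pt 2 → ℂ) (i : Fin 2) (p : Pt 2) : ℂ :=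
  if i = 0 then -(llow L 1 p) / sg L p else llow L 0 p / sg L p

/-- `m_i := g_{i j̄} m̄^j`. -/
def mlow (L : Pt 2 → ℂ) (i : Fin 2) (p : Pt 2) : ℂ :=
  ∑ j, gm L i j p * (starRingEnd ℂ) (mup L j p)

/-- `A := m^j m^k l_h C^h_{kj}`. -/
def sA (L : Pt 2 → ℂ) (p : Pt 2) : ℂ :=
  ∑ j, ∑ k, ∑ h, mup L j p * mup L k p * llow L h p * Cc L h k j p

/-- `B := m_h m^k m^j C^h_{jk}`. -/
def sB (L : Pt 2 → ℂ) (p : Pt 2) : ℂ :=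
  ∑ j, ∑ k, ∑ h, mlow L h p * mup L k p * mup L j p * Cc L h j k p

/-- `J := l^j l^k l_i L^i_{jk}`. -/
def sJ (L : Pt 2 → ℂ) (p : Pt 2) : ℂ :=
  ∑ j, ∑ k, ∑ i, lup L j p * lup L k p * llow L i p * Lc L i j k p

/-- `U := m^j l^k l_i L^i_{jk}`. -/
def sU (L : Pt 2 → ℂ) (p : Pt 2) : ℂ :=
  ∑ j, ∑ k, ∑ i, mup L j p * lup L k p * llow L i p * Lc L i j k p

/-- `V := l^j m^k l_i L^i_{jk}`. -/
def sV (L : Pt 2 → ℂ) (p : Pt 2) : ℂ :=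
  ∑ j, ∑ k, ∑ i, lup L j p * mup L k p * llow L i p * Lc L i j k p

/-- `X := m^j m^k l_i L^i_{jk}`. -/
def sX (L : Pt 2 → ℂ) (p : Pt 2) : ℂ :=
  ∑ j, ∑ k, ∑ i, mup L j p * mup L k p * llow L i p * Lc L i j k p

/-- `O := l^j l^k m_i L^i_{jk}`. -/
def sO (L : Pt 2 → ℂ) (p : Pt 2) : ℂ :=
  ∑ j, ∑ k, ∑ i, lup L j p * lup L k p * mlow L i p * Lc L i j k p

/-- `Y := m^j l^k m_i L^i_{jk}`. -/
def sY (L : Pt 2 → ℂ) (p : Pt 2) : ℂ :=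
  ∑ j, ∑ k, ∑ i, mup L j p * lup L k p * mlow L i p * Lc L i j k p

/-- `E := l^j m^k m_i L^i_{jk}`. -/
def sE (L : Pt 2 → ℂ) (p : Pt 2) : ℂ :=
  ∑ j, ∑ k, ∑ i, lup L j p * mup L k p * mlow L i p * Lc L i j k p

/-- `H := m^j m^k m_i L^i_{jk}`. -/
def sH (L : Pt 2 → ℂ) (p : Pt 2) : ℂ :=
  ∑ j, ∑ k, ∑ i, mup L j p * mup L k p * mlow L i p * Lc L i j k p

/-- The vertical curvature invariant `I := −(∂B/∂η̄^s) m̄^s − B B̄/2`. -/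
def vI (L : Pt 2 → ℂ) (p : Pt 2) : ℂ :=
  -(∑ s, debar (sB L) s p * (starRingEnd ℂ) (mup L s p)) -
    sB L p * (starRingEnd ℂ) (sB L p) / 2

/-- The `v v̄`-Riemann type tensor `S_{r̄ j h̄ k} := −g_{i r̄} ∂C^i_{jk}/∂η̄^h`. -/
def Sv (L : Pt 2 → ℂ) (r j h k : Fin 2) (p : Pt 2) : ℂ :=
  -∑ i, gm L i r p * debar (Cc L i j k) h p

/-- The `h h̄`-Riemann type tensor
`R_{r̄ j h̄ k} := g_{i r̄} (−δ_h̄(L^i_{jk}) − δ_h̄(N^l_k) C^i_{jl})`. -/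
def Rh (L : Pt 2 → ℂ) (r j h k : Fin 2) (p : Pt 2) : ℂ :=
  ∑ i, gm L i r p *
    (-(delbar L (Lc L i j k) h p) - ∑ l, delbar L (Nc L l k) h p * Cc L i j l p)

/-- The horizontal curvature invariant `K := −(1/F) δ_k̄(J) η̄^k`. -/
def hK (L : Pt 2 → ℂ) (p : Pt 2) : ℂ :=
  -(1 / Fh L p) * ∑ k, delbar L (sJ L) k p * (starRingEnd ℂ) (p.2 k)

/-- The horizontal curvature invariant
`W := −δ_s̄(H) m̄^s − ½ H (V̄+H̄) − B F δ_s̄(E) m̄^s`. -/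
def hW (L : Pt 2 → ℂ) (p : Pt 2) : ℂ :=
  -(∑ s, delbar L (sH L) s p * (starRingEnd ℂ) (mup L s p)) -
    (1 / 2) * sH L p * ((starRingEnd ℂ) (sV L p) + (starRingEnd ℂ) (sH L p)) -
    sB L p * Fh L p * ∑ s, delbar L (sE L) s p * (starRingEnd ℂ) (mup L s p)

/-- The weak symmetry condition `R_{0̄ k 0̄ 0} = R_{0̄ 0 0̄ k}`, i.e.
`R_{r̄ k h̄ s} η̄^r η̄^h η^s = R_{r̄ s h̄ k} η̄^r η^s η̄^h`. -/
def WeakSym (L : Pt 2 → ℂ) (D : Set (Pt 2)) : Prop :=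
  ∀ p ∈ D, ∀ k,
    (∑ r, ∑ h, ∑ s, Rh L r k h s p * (starRingEnd ℂ) (p.2 r) *
      (starRingEnd ℂ) (p.2 h) * p.2 s) =
    ∑ r, ∑ s, ∑ h, Rh L r s h k p * (starRingEnd ℂ) (p.2 r) * p.2 s *
      (starRingEnd ℂ) (p.2 h)


section Wirtinger

variable {E : Type*} [NormedAddCommGroup E] [NormedSpace ℝ E]

/-- The functional `φ ↦ ½ (φ v - i φ w)` on real-linear forms; applied to `fderiv ℝ f p` it yields
the Wirtinger derivatives. -/
def wirt (v w : E) : (E →L[ℝ] ℂ) →ₗ[ℂ] ℂ where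
  toFun φ := (1 / 2) * (φ v - I * φ w)
  map_add' φ ψ := by simp only [add_apply]; ring
  map_smul' c φ := by
    simp only [smul_apply, smul_eq_mul, RingHom.id_apply]; ring

theorem wirt_apply (v w : E) (φ : E →L[ℝ] ℂ) : wirt v w φ = (1 / 2) * (φ v - I * φ w) := rfl

theorem map_fderiv_mul (Φ : (E →L[ℝ] ℂ) →ₗ[ℂ] ℂ) {f g : E → ℂ} {p : E}
    (hf : DifferentiableAt ℝ f p) (hg : DifferentiableAt ℝ g p) :
    Φ (fderiv ℝ (fun q => f q * g q) p) =
      f p * Φ (fderiv ℝ g p) + Φ (fderiv ℝ f p) * g p := by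
  rw [fderiv_fun_mul hf hg, map_add, map_smul, map_smul, smul_eq_mul, smul_eq_mul,
    mul_comm (g p)]

theorem map_fderiv_sum (Φ : (E →L[ℝ] ℂ) →ₗ[ℂ] ℂ) {ι : Type*} [Fintype ι] {f : ι → E → ℂ} {p : E}
    (hf : ∀ i, DifferentiableAt ℝ (f i) p) :
    Φ (fderiv ℝ (fun q => ∑ i, f i q) p) = ∑ i, Φ (fderiv ℝ (f i) p) := by
  rw [fderiv_fun_sum fun i _ => hf i, map_sum]

theorem map_fderiv_sum_mul (Φ : (E →L[ℝ] ℂ) →ₗ[ℂ] ℂ) {ι : Type*} [Fintype ι] {f g : ι → E → ℂ}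
    {p : E} (hf : ∀ i, DifferentiableAt ℝ (f i) p) (hg : ∀ i, DifferentiableAt ℝ (g i) p) :
    Φ (fderiv ℝ (fun q => ∑ i, f i q * g i q) p) =
      ∑ i, (f i p * Φ (fderiv ℝ (g i) p) + Φ (fderiv ℝ (f i) p) * g i p) := by
  rw [map_fderiv_sum Φ fun i => (hf i).fun_mul (hg i)]
  exact Finset.sum_congr rfl fun i _ => map_fderiv_mul Φ (hf i) (hg i)

theorem map_fderiv_congr (Φ : (E →L[ℝ] ℂ) →ₗ[ℂ] ℂ) {f g : E → ℂ} {D : Set E} (hD : IsOpen D)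
    (h : ∀ q ∈ D, f q = g q) {p : E} (hp : p ∈ D) :
    Φ (fderiv ℝ f p) = Φ (fderiv ℝ g p) := by
  rw [Filter.EventuallyEq.fderiv_eq (Filter.eventually_of_mem (hD.mem_nhds hp) h)]

theorem contDiffOn_wirt {f : E → ℂ} {D : Set E} (hD : IsOpen D)
    (hf : ContDiffOn ℝ (⊤ : ℕ∞) f D) (v w : E) :
    ContDiffOn ℝ (⊤ : ℕ∞) (fun p => wirt v w (fderiv ℝ f p)) D := by
  have h : ContDiffOn ℝ (⊤ : ℕ∞) (fderiv ℝ f) D := hf.fderiv_of_isOpen hD (by simp)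
  exact contDiffOn_const.mul ((h.clm_apply contDiffOn_const).sub
    (contDiffOn_const.mul (h.clm_apply contDiffOn_const)))

theorem differentiableAt_of_contDiffOn {F : Type*} [NormedAddCommGroup F] [NormedSpace ℝ F]
    {f : E → F} {D : Set E} (hD : IsOpen D)
    (hf : ContDiffOn ℝ (⊤ : ℕ∞) f D) {p : E} (hp : p ∈ D) : DifferentiableAt ℝ f p :=
  (hf.contDiffAt (hD.mem_nhds hp)).differentiableAt (by simp)

theorem fderiv_wirt {f : E → ℂ} {D : Set E} (hD : IsOpen D)
    (hf : ContDiffOn ℝ (⊤ : ℕ∞) f D) (v w u : E) {p : E} (hp : p ∈ D) :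
    fderiv ℝ (fun q => wirt v w (fderiv ℝ f q)) p u =
      wirt v w (fderiv ℝ (fderiv ℝ f) p u) := by
  have h : DifferentiableAt ℝ (fderiv ℝ f) p :=
    differentiableAt_of_contDiffOn hD (hf.fderiv_of_isOpen (m := (⊤ : ℕ∞)) hD (by simp)) hp
  have h1 : ∀ x : E, HasFDerivAt (fun q => fderiv ℝ f q x)
      ((ContinuousLinearMap.apply ℝ ℂ x).comp (fderiv ℝ (fderiv ℝ f) p)) p := fun x =>
    (ContinuousLinearMap.apply ℝ ℂ x).hasFDerivAt.comp p h.hasFDerivAt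
  have h2 := ((h1 v).sub ((h1 w).const_mul I)).const_mul (1 / 2 : ℂ)
  have h3 : HasFDerivAt (fun q => wirt v w (fderiv ℝ f q)) _ p := h2
  rw [h3.fderiv]
  simp [wirt_apply]

theorem wirt_comm {f : E → ℂ} {D : Set E} (hD : IsOpen D)
    (hf : ContDiffOn ℝ (⊤ : ℕ∞) f D) (v w v' w' : E) {p : E} (hp : p ∈ D) :
    wirt v w (fderiv ℝ (fun q => wirt v' w' (fderiv ℝ f q)) p) =
      wirt v' w' (fderiv ℝ (fun q => wirt v w (fderiv ℝ f q)) p) := by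
  have hs : IsSymmSndFDerivAt ℝ f p :=
    (hf.contDiffAt (hD.mem_nhds hp)).isSymmSndFDerivAt
      (by
        rw [minSmoothness_of_isRCLikeNormedField]
        exact WithTop.coe_le_coe.2 (le_top : (2 : ℕ∞) ≤ ⊤))
  rw [wirt_apply v w, wirt_apply v' w']
  simp only [fderiv_wirt hD hf _ _ _ hp]
  simp only [wirt_apply]
  rw [hs.eq v v', hs.eq v w', hs.eq w v', hs.eq w w']
  ring

end Wirtinger

/-- The functional underlying `∂/∂z^k`. -/
def zForm (k : Fin n) : (Pt n →L[ℝ] ℂ) →ₗ[ℂ] ℂ :=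
  wirt ((Pi.single k 1 : Fin n → ℂ), 0) ((Pi.single k I : Fin n → ℂ), 0)

/-- The functional underlying `∂/∂η^k`. -/
def eForm (k : Fin n) : (Pt n →L[ℝ] ℂ) →ₗ[ℂ] ℂ :=
  wirt (0, (Pi.single k 1 : Fin n → ℂ)) (0, (Pi.single k I : Fin n → ℂ))

/-- The functional underlying `∂/∂η̄^k`. -/
def ebarForm (k : Fin n) : (Pt n →L[ℝ] ℂ) →ₗ[ℂ] ℂ :=
  wirt (0, (Pi.single k 1 : Fin n → ℂ)) (-(0, (Pi.single k I : Fin n → ℂ)))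

theorem dz_eq (f : Pt n → ℂ) (k : Fin n) (p : Pt n) : dz f k p = zForm k (fderiv ℝ f p) := rfl

theorem de_eq (f : Pt n → ℂ) (k : Fin n) (p : Pt n) : de f k p = eForm k (fderiv ℝ f p) := rfl

theorem debar_eq (f : Pt n → ℂ) (k : Fin n) (p : Pt n) :
    debar f k p = ebarForm k (fderiv ℝ f p) := by
  simp only [debar, ebarForm, wirt_apply, map_neg]
  ring

theorem debar_eq_fun (f : Pt n → ℂ) (k : Fin n) :
    debar f k = fun p => ebarForm k (fderiv ℝ f p) := funext fun p => debar_eq f k p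

/-- The fibre coordinate `η^l`. -/
def fib (l : Fin n) (p : Pt n) : ℂ := p.2 l

/-- The conjugate fibre coordinate `η̄^l`. -/
def fibbar (l : Fin n) (p : Pt n) : ℂ := (starRingEnd ℂ) (p.2 l)

theorem contDiff_fib (l : Fin n) : ContDiff ℝ (⊤ : ℕ∞) (fib l : Pt n → ℂ) :=
  (ContinuousLinearMap.proj (R := ℝ) (φ := fun _ : Fin n => ℂ) l ∘L
    ContinuousLinearMap.snd ℝ (Fin n → ℂ) (Fin n → ℂ)).contDiff

theorem contDiff_fibbar (l : Fin n) : ContDiff ℝ (⊤ : ℕ∞) (fibbar l : Pt n → ℂ) :=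
  conjCLE.contDiff.comp (contDiff_fib l)

theorem differentiableAt_fib (l : Fin n) (p : Pt n) : DifferentiableAt ℝ (fib l) p :=
  ((contDiff_fib l).differentiable (by simp)).differentiableAt

theorem differentiableAt_fibbar (l : Fin n) (p : Pt n) : DifferentiableAt ℝ (fibbar l) p :=
  ((contDiff_fibbar l).differentiable (by simp)).differentiableAt

theorem fderiv_fib (l : Fin n) (p u : Pt n) : fderiv ℝ (fib l) p u = u.2 l :=
  congrArg (· u) (ContinuousLinearMap.proj (R := ℝ) (φ := fun _ : Fin n => ℂ) l ∘L
    ContinuousLinearMap.snd ℝ (Fin n → ℂ) (Fin n → ℂ)).fderiv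

theorem fderiv_fibbar (l : Fin n) (p u : Pt n) :
    fderiv ℝ (fibbar l) p u = (starRingEnd ℂ) (u.2 l) :=
  congrArg (· u) ((conjCLE : ℂ →L[ℝ] ℂ) ∘L
    ContinuousLinearMap.proj (R := ℝ) (φ := fun _ : Fin n => ℂ) l ∘L
    ContinuousLinearMap.snd ℝ (Fin n → ℂ) (Fin n → ℂ)).fderiv

theorem dz_fib (k l : Fin n) (p : Pt n) : dz (fib l) k p = 0 := by
  simp [dz_eq, zForm, wirt_apply, fderiv_fib]

theorem dz_fibbar (k l : Fin n) (p : Pt n) : dz (fibbar l) k p = 0 := by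
  simp [dz_eq, zForm, wirt_apply, fderiv_fibbar]

theorem de_fib (k l : Fin n) (p : Pt n) :
    de (fib l) k p = if l = k then 1 else 0 := by
  rw [de_eq, eForm, wirt_apply, fderiv_fib, fderiv_fib]
  by_cases h : l = k
  · subst h
    simp
    norm_num
  · simp [h]

theorem de_fibbar (k l : Fin n) (p : Pt n) : de (fibbar l) k p = 0 := by
  rw [de_eq, eForm, wirt_apply, fderiv_fibbar, fderiv_fibbar]
  by_cases h : l = k
  · subst h
    simp
  · simp [h]

theorem debar_fib (k l : Fin n) (p : Pt n) : debar (fib l) k p = 0 := by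
  rw [debar_eq, ebarForm, wirt_apply, fderiv_fib, fderiv_fib]
  by_cases h : l = k
  · subst h
    simp
  · simp [h]

theorem apply_eq_sum_eForm (φ : Pt n →L[ℝ] ℂ) (v : Fin n → ℂ) :
    φ (0, v) = ∑ l, (v l * eForm l φ + (starRingEnd ℂ) (v l) * ebarForm l φ) := by
  have h : ((0, v) : Pt n) = ∑ l, ((v l).re • ((0, Pi.single l 1) : Pt n) +
      (v l).im • ((0, Pi.single l I) : Pt n)) := by
    refine Prod.ext ?_ ?_
    · simp [Prod.fst_sum]
    · ext i
      simp [Prod.snd_sum, Finset.sum_apply, Finset.sum_add_distrib, Pi.single_apply]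
  rw [h, map_sum]
  refine Finset.sum_congr rfl fun l _ => ?_
  simp only [map_add, map_smul, eForm, ebarForm, wirt_apply, map_neg, real_smul]
  apply Complex.ext <;> simp <;> ring

namespace IsCFM

variable {D : Set (Pt n)} {L : Pt n → ℂ}

theorem fderiv_smul_fiber (hL : IsCFM n D L) {p : Pt n} (hp : p ∈ D) (c : ℂ) :
    fderiv ℝ L p (0, c • p.2) = 2 * c.re * L p := by
  have hγ : HasDerivAt (fun t : ℝ => ((p.1, (1 + t * c) • p.2) : Pt n)) (0, c • p.2) 0 := by
    refine (hasDerivAt_const 0 p.1).prodMk ?_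
    have h : HasDerivAt (fun t : ℝ => (1 + t * c : ℂ)) c 0 := by
      simpa using ((ofRealCLM.hasDerivAt (x := 0)).mul_const c).const_add 1
    exact h.smul_const p.2
  have hd : HasFDerivAt L (fderiv ℝ L p) ((p.1, (1 + ((0 : ℝ) : ℂ) * c) • p.2) : Pt n) := by
    simpa using (differentiableAt_of_contDiffOn hL.openD hL.smooth hp).hasFDerivAt
  have h1 := hd.comp_hasDerivAt (0 : ℝ) hγ
  have h2 : HasDerivAt (fun t : ℝ => (((1 + t * c.re) ^ 2 + (t * c.im) ^ 2 : ℝ) : ℂ) * L p)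
      (2 * c.re * L p) 0 := by
    have hre : HasDerivAt (fun t : ℝ => (1 + t * c.re) ^ 2 + (t * c.im) ^ 2) (2 * c.re) 0 := by
      have h := ((((hasDerivAt_id (0 : ℝ)).mul_const c.re).const_add 1).pow 2).add
        (((hasDerivAt_id (0 : ℝ)).mul_const c.im).pow 2)
      refine (h.congr_deriv (by simp)).congr_of_eventuallyEq (.of_forall fun t => ?_)
      simp
    simpa using hre.ofReal_comp.mul_const (L p)
  refine h1.unique (h2.congr_of_eventuallyEq ?_)
  have hc : ContinuousAt (fun t : ℝ => (1 + t * c : ℂ)) 0 := by fun_prop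
  filter_upwards [hc.eventually_ne (y := 0) (by simp)] with t ht
  simp only [Function.comp]
  rw [hL.homog p hp _ ht, normSq_apply]
  simp [pow_two]

/-- Euler's identities for a function of bidegree `(1, 1)`. -/
theorem euler (hL : IsCFM n D L) {p : Pt n} (hp : p ∈ D) :
    ∑ l, p.2 l * de L l p = L p ∧ ∑ l, (starRingEnd ℂ) (p.2 l) * debar L l p = L p := by
  have h1 := hL.fderiv_smul_fiber hp 1
  have h2 := hL.fderiv_smul_fiber hp I
  rw [apply_eq_sum_eForm, Finset.sum_add_distrib] at h1 h2
  simp only [Pi.smul_apply, smul_eq_mul, map_mul, conj_I, one_mul, one_re, I_re,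
    mul_assoc, ← Finset.mul_sum, ← de_eq, ← debar_eq] at h1 h2
  push_cast at h1 h2
  constructor
  · linear_combination (1 / 2) * h1 - (I / 2) * h2 +
      (∑ l, p.2 l * de L l p - ∑ l, (starRingEnd ℂ) (p.2 l) * debar L l p) / 2 * I_sq
  · linear_combination (1 / 2) * h1 + (I / 2) * h2 -
      (∑ l, p.2 l * de L l p - ∑ l, (starRingEnd ℂ) (p.2 l) * debar L l p) / 2 * I_sq

end IsCFM

theorem contDiffOn_det {E : Type*} [NormedAddCommGroup E] [NormedSpace ℝ E] {D : Set E}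
    {M : E → Matrix (Fin n) (Fin n) ℂ}
    (h : ∀ i j, ContDiffOn ℝ (⊤ : ℕ∞) (fun q => M q i j) D) :
    ContDiffOn ℝ (⊤ : ℕ∞) (fun q => (M q).det) D := by
  simp only [Matrix.det_apply']
  exact ContDiffOn.sum fun σ _ => contDiffOn_const.mul (contDiffOn_prod fun i _ => h _ _)

theorem contDiffOn_inv_apply {E : Type*} [NormedAddCommGroup E] [NormedSpace ℝ E] {D : Set E}
    {M : E → Matrix (Fin n) (Fin n) ℂ}
    (h : ∀ i j, ContDiffOn ℝ (⊤ : ℕ∞) (fun q => M q i j) D) (hM : ∀ q ∈ D, (M q).det ≠ 0)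
    (i j : Fin n) : ContDiffOn ℝ (⊤ : ℕ∞) (fun q => (M q)⁻¹ i j) D := by
  simp only [Matrix.inv_def, Matrix.smul_apply, Ring.inverse_eq_inv', smul_eq_mul,
    Matrix.adjugate_apply]
  refine ((contDiffOn_det h).inv hM).mul (contDiffOn_det fun a b => ?_)
  by_cases hab : a = j
  · subst hab
    simpa using contDiffOn_const
  · simpa [Matrix.updateRow_ne hab] using h a b

/-- The functional underlying the spray derivation `η^k δ_k`. -/
def sprayForm (L : Pt n → ℂ) (p : Pt n) : (Pt n →L[ℝ] ℂ) →ₗ[ℂ] ℂ :=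
  ∑ k, p.2 k • (zForm k - ∑ j, Nc L j k p • eForm j)

theorem sum_del_mul (L f : Pt n → ℂ) (p : Pt n) :
    ∑ k, del L f k p * p.2 k = sprayForm L p (fderiv ℝ f p) := by
  simp only [sprayForm, LinearMap.sum_apply, LinearMap.smul_apply, LinearMap.sub_apply,
    smul_eq_mul, del, dz_eq, de_eq]
  exact Finset.sum_congr rfl fun k _ => mul_comm _ _

theorem sprayForm_fderiv (L f : Pt n → ℂ) (p : Pt n) :
    sprayForm L p (fderiv ℝ f p) =
      ∑ k, fib k p * dz f k p - 2 * ∑ j, Gs L j p * de f j p := by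
  rw [← sum_del_mul]
  simp only [del, sub_mul, Finset.sum_sub_distrib, Gs, Finset.mul_sum, Finset.sum_mul, fib]
  rw [Finset.sum_comm]
  congr 1
  · exact Finset.sum_congr rfl fun k _ => mul_comm _ _
  · exact Finset.sum_congr rfl fun k _ => Finset.sum_congr rfl fun j _ => by ring

theorem sprayForm_fibbar (L : Pt n → ℂ) (l : Fin n) (p : Pt n) :
    sprayForm L p (fderiv ℝ (fibbar l) p) = 0 := by
  simp [sprayForm_fderiv, dz_fibbar, de_fibbar]

namespace IsCFM

variable {D : Set (Pt n)} {L : Pt n → ℂ}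

section Smoothness

variable {f : Pt n → ℂ}

theorem contDiffOn_dz (hL : IsCFM n D L) (hf : ContDiffOn ℝ (⊤ : ℕ∞) f D) (k : Fin n) :
    ContDiffOn ℝ (⊤ : ℕ∞) (dz f k) D := contDiffOn_wirt hL.openD hf _ _

theorem contDiffOn_de (hL : IsCFM n D L) (hf : ContDiffOn ℝ (⊤ : ℕ∞) f D) (k : Fin n) :
    ContDiffOn ℝ (⊤ : ℕ∞) (de f k) D := contDiffOn_wirt hL.openD hf _ _

theorem contDiffOn_debar (hL : IsCFM n D L) (hf : ContDiffOn ℝ (⊤ : ℕ∞) f D) (k : Fin n) :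
    ContDiffOn ℝ (⊤ : ℕ∞) (debar f k) D := by
  rw [debar_eq_fun]
  exact contDiffOn_wirt hL.openD hf _ _

theorem contDiffOn_gm (hL : IsCFM n D L) (i j : Fin n) :
    ContDiffOn ℝ (⊤ : ℕ∞) (gm L i j) D :=
  hL.contDiffOn_de (hL.contDiffOn_debar hL.smooth j) i

theorem differentiableAt (hL : IsCFM n D L) (hf : ContDiffOn ℝ (⊤ : ℕ∞) f D) {p : Pt n}
    (hp : p ∈ D) : DifferentiableAt ℝ f p := differentiableAt_of_contDiffOn hL.openD hf hp

theorem differentiableAt_gm (hL : IsCFM n D L) {p : Pt n} (hp : p ∈ D) (i j : Fin n) :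
    DifferentiableAt ℝ (gm L i j) p := hL.differentiableAt (hL.contDiffOn_gm i j) hp

theorem de_comm (hL : IsCFM n D L) (hf : ContDiffOn ℝ (⊤ : ℕ∞) f D) {p : Pt n} (hp : p ∈ D)
    (j k : Fin n) : de (de f j) k p = de (de f k) j p := wirt_comm hL.openD hf _ _ _ _ hp

theorem de_dz_comm (hL : IsCFM n D L) (hf : ContDiffOn ℝ (⊤ : ℕ∞) f D) {p : Pt n} (hp : p ∈ D)
    (j k : Fin n) : de (dz f j) k p = dz (de f k) j p := wirt_comm hL.openD hf _ _ _ _ hp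

theorem de_debar_comm (hL : IsCFM n D L) (hf : ContDiffOn ℝ (⊤ : ℕ∞) f D) {p : Pt n}
    (hp : p ∈ D) (j k : Fin n) : debar (de f j) k p = de (debar f k) j p := by
  rw [debar_eq, debar_eq_fun]
  exact wirt_comm hL.openD hf _ _ _ _ hp

end Smoothness

theorem det_ne_zero (hL : IsCFM n D L) {p : Pt n} (hp : p ∈ D) : (gmat L p).det ≠ 0 := by
  intro h
  obtain ⟨v, hv, h0⟩ := Matrix.exists_vecMul_eq_zero_iff.2 h
  have hpos := hL.posdef p hp v hv
  rw [Finset.sum_comm] at hpos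
  have hz : ∀ j, ∑ i, gm L i j p * v i = 0 := fun j => by
    simpa [Matrix.vecMul, dotProduct, gmat, mul_comm] using congrFun h0 j
  simp [← Finset.sum_mul, hz] at hpos

theorem sum_gi_mul_gm (hL : IsCFM n D L) {p : Pt n} (hp : p ∈ D) (l r : Fin n) :
    ∑ i, gi L l i p * gm L i r p = if l = r then 1 else 0 := by
  have h := Matrix.nonsing_inv_mul (gmat L p) (isUnit_iff_ne_zero.2 (hL.det_ne_zero hp))
  simpa [Matrix.mul_apply, Matrix.one_apply, gi, gmat] using congrFun (congrFun h l) r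

theorem sum_gm_mul_gi (hL : IsCFM n D L) {p : Pt n} (hp : p ∈ D) (j i : Fin n) :
    ∑ l, gm L j l p * gi L l i p = if j = i then 1 else 0 := by
  have h := Matrix.mul_nonsing_inv (gmat L p) (isUnit_iff_ne_zero.2 (hL.det_ne_zero hp))
  simpa [Matrix.mul_apply, Matrix.one_apply, gi, gmat] using congrFun (congrFun h j) i

/-- Lowering an index raised with `g^{l̄ i}`. -/
theorem sum_raise_mul_gm (hL : IsCFM n D L) {p : Pt n} (hp : p ∈ D) (a : Fin n → ℂ) (r : Fin n) :
    ∑ i, (∑ l, gi L l i p * a l) * gm L i r p = a r := by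
  simp only [Finset.sum_mul]
  rw [Finset.sum_comm]
  simp only [mul_right_comm _ (a _), ← Finset.sum_mul, hL.sum_gi_mul_gm hp]
  simp

theorem lower_injective (hL : IsCFM n D L) {p : Pt n} (hp : p ∈ D) {a b : Fin n → ℂ}
    (h : ∀ r, ∑ i, a i * gm L i r p = ∑ i, b i * gm L i r p) (i : Fin n) : a i = b i := by
  have key : ∀ c : Fin n → ℂ, ∑ r, (∑ j, c j * gm L j r p) * gi L r i p = c i := fun c => by
    simp only [Finset.sum_mul]
    rw [Finset.sum_comm]
    simp only [mul_assoc, ← Finset.mul_sum, hL.sum_gm_mul_gi hp]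
    simp
  rw [← key a, ← key b]
  simp only [h]

theorem sum_fib_mul_gm (hL : IsCFM n D L) {p : Pt n} (hp : p ∈ D) (m : Fin n) :
    ∑ l, fib l p * gm L l m p = debar L m p := by
  have h := map_fderiv_congr (ebarForm m) hL.openD (f := fun q => ∑ l, fib l q * de L l q)
    (fun q hq => (hL.euler hq).1) hp
  rw [map_fderiv_sum_mul _ (differentiableAt_fib · p) fun i =>
    hL.differentiableAt (hL.contDiffOn_de hL.smooth i) hp] at h
  simp only [debar_fib, zero_mul, add_zero,
    ← debar_eq, hL.de_debar_comm hL.smooth hp] at h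
  exact h

theorem sum_fibbar_mul_gm (hL : IsCFM n D L) {p : Pt n} (hp : p ∈ D) (i : Fin n) :
    ∑ m, fibbar m p * gm L i m p = de L i p := by
  have h := map_fderiv_congr (eForm i) hL.openD (f := fun q => ∑ m, fibbar m q * debar L m q)
    (fun q hq => (hL.euler hq).2) hp
  rw [map_fderiv_sum_mul _ (differentiableAt_fibbar · p) fun i =>
    hL.differentiableAt (hL.contDiffOn_debar hL.smooth i) hp] at h
  simp only [de_fibbar, zero_mul, add_zero,
    ← de_eq] at h
  exact h

theorem sum_fib_mul_dz_gm (hL : IsCFM n D L) {p : Pt n} (hp : p ∈ D) (m k : Fin n) :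
    ∑ l, fib l p * dz (gm L l m) k p = dz (debar L m) k p := by
  have h := map_fderiv_congr (zForm k) hL.openD (f := fun q => ∑ l, fib l q * gm L l m q)
    (fun q hq => hL.sum_fib_mul_gm hq m) hp
  rw [map_fderiv_sum_mul _ (differentiableAt_fib · p) fun i =>
    hL.differentiableAt_gm hp i m] at h
  simp only [dz_fib, zero_mul, add_zero, ← dz_eq] at h
  exact h

theorem sum_fib_mul_de_gm (hL : IsCFM n D L) {p : Pt n} (hp : p ∈ D) (m k : Fin n) :
    ∑ l, fib l p * de (gm L l m) k p = 0 := by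
  have h := map_fderiv_congr (eForm k) hL.openD (f := fun q => ∑ l, fib l q * gm L l m q)
    (fun q hq => hL.sum_fib_mul_gm hq m) hp
  rw [map_fderiv_sum_mul _ (differentiableAt_fib · p) fun i =>
    hL.differentiableAt_gm hp i m] at h
  simp only [de_fib, Finset.sum_add_distrib, ite_mul, one_mul, zero_mul,
    Finset.sum_ite_eq', Finset.mem_univ, if_true, ← de_eq] at h
  simpa [gm] using h

theorem de_gm_symm (hL : IsCFM n D L) {p : Pt n} (hp : p ∈ D) (i l j : Fin n) :
    de (gm L i l) j p = de (gm L j l) i p :=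
  hL.de_comm (hL.contDiffOn_debar hL.smooth l) hp i j

theorem sum_Nc_mul_gm (hL : IsCFM n D L) {p : Pt n} (hp : p ∈ D) (k m : Fin n) :
    ∑ i, Nc L i k p * gm L i m p = dz (debar L m) k p := by
  rw [← hL.sum_fib_mul_dz_gm hp,
    ← hL.sum_raise_mul_gm hp (fun m => ∑ l, fib l p * dz (gm L l m) k p) m]
  simp only [Nc, Finset.mul_sum, mul_assoc, mul_comm (dz _ _ _), fib]

theorem sum_Lc_mul_gm (hL : IsCFM n D L) {p : Pt n} (hp : p ∈ D) (j k m : Fin n) :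
    ∑ i, Lc L i j k p * gm L i m p = del L (gm L j m) k p :=
  hL.sum_raise_mul_gm hp (fun l => del L (gm L j l) k p) m

theorem sum_Cc_mul_gm (hL : IsCFM n D L) {p : Pt n} (hp : p ∈ D) (j k m : Fin n) :
    ∑ i, Cc L i j k p * gm L i m p = de (gm L j m) k p :=
  hL.sum_raise_mul_gm hp (fun l => de (gm L j l) k p) m

theorem sum_Gs_mul_gm (hL : IsCFM n D L) {p : Pt n} (hp : p ∈ D) (m : Fin n) :
    ∑ i, Gs L i p * gm L i m p = (1 / 2) * ∑ k, fib k p * dz (debar L m) k p := by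
  simp only [← hL.sum_Nc_mul_gm hp, Gs, Finset.mul_sum, Finset.sum_mul]
  rw [Finset.sum_comm]
  exact Finset.sum_congr rfl fun k _ => Finset.sum_congr rfl fun i _ => by rw [fib]; ring

theorem contDiffOn_gi (hL : IsCFM n D L) (l i : Fin n) :
    ContDiffOn ℝ (⊤ : ℕ∞) (gi L l i) D :=
  contDiffOn_inv_apply (M := gmat L) (fun i j => hL.contDiffOn_gm i j)
    (fun _ hq => hL.det_ne_zero hq) l i

theorem contDiffOn_Nc (hL : IsCFM n D L) (i k : Fin n) :
    ContDiffOn ℝ (⊤ : ℕ∞) (Nc L i k) D :=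
  ContDiffOn.sum fun m _ => ContDiffOn.sum fun l _ =>
    ((hL.contDiffOn_gi m i).mul (hL.contDiffOn_dz (hL.contDiffOn_gm l m) k)).mul
      (contDiff_fib l).contDiffOn

theorem contDiffOn_Gs (hL : IsCFM n D L) (i : Fin n) :
    ContDiffOn ℝ (⊤ : ℕ∞) (Gs L i) D :=
  contDiffOn_const.mul <| ContDiffOn.sum fun j _ =>
    (hL.contDiffOn_Nc i j).mul (contDiff_fib j).contDiffOn

end IsCFM

/-- The contraction `L^i_{jk} η^k`. -/
def sprayLc (L : Pt n → ℂ) (i j : Fin n) (p : Pt n) : ℂ := ∑ k, Lc L i j k p * p.2 k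

namespace IsCFM

variable {D : Set (Pt n)} {L : Pt n → ℂ}

theorem sum_Lc_mul_fib (hL : IsCFM n D L) {p : Pt n} (hp : p ∈ D) (i j : Fin n) :
    ∑ k, Lc L i k j p * p.2 k = Nc L i j p := by
  refine hL.lower_injective hp (a := fun i => ∑ k, Lc L i k j p * p.2 k)
    (b := fun i => Nc L i j p) (fun r => ?_) i
  have h : ∑ i, (∑ k, Lc L i k j p * p.2 k) * gm L i r p =
      ∑ k, fib k p * ∑ i, Lc L i k j p * gm L i r p := by
    simp only [Finset.sum_mul, Finset.mul_sum]
    rw [Finset.sum_comm]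
    exact Finset.sum_congr rfl fun k _ => Finset.sum_congr rfl fun i _ => by rw [fib]; ring
  have h0 : ∑ k, ∑ m, fib k p * (Nc L m j p * de (gm L k r) m p) = 0 := by
    rw [Finset.sum_comm]
    simp only [mul_left_comm (fib _ p), ← Finset.mul_sum, hL.sum_fib_mul_de_gm hp, mul_zero,
      Finset.sum_const_zero]
  rw [h, hL.sum_Nc_mul_gm hp, ← hL.sum_fib_mul_dz_gm hp]
  simp only [hL.sum_Lc_mul_gm hp, del, mul_sub, Finset.sum_sub_distrib, Finset.mul_sum, h0,
    sub_zero]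

theorem sprayForm_gm (hL : IsCFM n D L) {p : Pt n} (hp : p ∈ D) (j r : Fin n) :
    sprayForm L p (fderiv ℝ (gm L j r) p) = ∑ i, sprayLc L i j p * gm L i r p := by
  simp only [← sum_del_mul, ← hL.sum_Lc_mul_gm hp, sprayLc, Finset.sum_mul]
  rw [Finset.sum_comm]
  exact Finset.sum_congr rfl fun k _ => Finset.sum_congr rfl fun i _ => by ring

theorem sprayForm_debar (hL : IsCFM n D L) {p : Pt n} (hp : p ∈ D) (m : Fin n) :
    sprayForm L p (fderiv ℝ (debar L m) p) = 0 := by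
  rw [sprayForm_fderiv]
  change _ - 2 * ∑ j, Gs L j p * gm L j m p = 0
  rw [hL.sum_Gs_mul_gm hp]
  ring

theorem sprayForm_self (hL : IsCFM n D L) {p : Pt n} (hp : p ∈ D) :
    sprayForm L p (fderiv ℝ L p) = 0 := by
  have h := map_fderiv_congr (sprayForm L p) hL.openD
    (f := fun q => ∑ m, fibbar m q * debar L m q) (fun q hq => (hL.euler hq).2) hp
  rw [map_fderiv_sum_mul _ (differentiableAt_fibbar · p) fun i =>
    hL.differentiableAt (hL.contDiffOn_debar hL.smooth i) hp] at h
  simpa only [sprayForm_fibbar, hL.sprayForm_debar hp, mul_zero, zero_mul, add_zero,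
    Finset.sum_const_zero, eq_comm] using h

theorem sum_de_Gs_mul_gm (hL : IsCFM n D L) {p : Pt n} (hp : p ∈ D) (j m : Fin n) :
    ∑ i, (Gs L i p * de (gm L i m) j p + de (Gs L i) j p * gm L i m p) =
      (1 / 2) * (∑ k, fib k p * dz (gm L j m) k p + dz (debar L m) j p) := by
  have hd : ∀ k, ContDiffOn ℝ (⊤ : ℕ∞) (dz (debar L m) k) D := fun k =>
    hL.contDiffOn_dz (hL.contDiffOn_debar hL.smooth m) k
  have h := map_fderiv_congr (eForm j) hL.openD (f := fun q => ∑ i, Gs L i q * gm L i m q)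
    (fun q hq => hL.sum_Gs_mul_gm hq m) hp
  rw [map_fderiv_sum_mul _ (fun i => hL.differentiableAt (hL.contDiffOn_Gs i) hp) fun i =>
    hL.differentiableAt_gm hp i m, map_fderiv_mul _ (differentiableAt_const _)
    (.fun_sum fun k _ => (differentiableAt_fib k p).fun_mul (hL.differentiableAt (hd k) hp)),
    map_fderiv_sum_mul _ (differentiableAt_fib · p) fun k => hL.differentiableAt (hd k) hp] at h
  simp only [← de_eq, hL.de_dz_comm (hL.contDiffOn_debar hL.smooth m) hp, de_fib, ite_mul, one_mul,
    zero_mul, Finset.sum_add_distrib, Finset.sum_ite_eq', Finset.mem_univ, if_true,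
    fderiv_fun_const, Pi.zero_apply, map_zero, add_zero] at h
  rw [Finset.sum_add_distrib]
  exact h

theorem two_mul_de_Gs (hL : IsCFM n D L) {p : Pt n} (hp : p ∈ D) (i j : Fin n) :
    2 * de (Gs L i) j p = sprayLc L i j p + Nc L i j p := by
  refine hL.lower_injective hp (a := fun i => 2 * de (Gs L i) j p)
    (b := fun i => sprayLc L i j p + Nc L i j p) (fun r => ?_) i
  have h := hL.sum_de_Gs_mul_gm hp j r
  simp only [add_mul, mul_assoc, Finset.sum_add_distrib, ← Finset.mul_sum,
    ← hL.sprayForm_gm hp, hL.sum_Nc_mul_gm hp, sprayForm_fderiv] at h ⊢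
  simp only [hL.de_gm_symm hp j r]
  linear_combination 2 * h

theorem sum_de_de_Gs_mul_gm (hL : IsCFM n D L) {p : Pt n} (hp : p ∈ D) (j m r : Fin n) :
    2 * ∑ i, de (de (Gs L i) j) m p * gm L i r p =
      sprayForm L p (fderiv ℝ (de (gm L j r) m) p) + dz (gm L j r) m p + dz (gm L m r) j p -
        2 * ∑ i, de (Gs L i) m p * de (gm L j r) i p -
        2 * ∑ i, de (Gs L i) j p * de (gm L i r) m p := by
  have hd : ∀ k, ContDiffOn ℝ (⊤ : ℕ∞) (dz (gm L j r) k) D := fun k =>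
    hL.contDiffOn_dz (hL.contDiffOn_gm j r) k
  have hd' : ContDiffOn ℝ (⊤ : ℕ∞) (dz (debar L r) j) D :=
    hL.contDiffOn_dz (hL.contDiffOn_debar hL.smooth r) j
  have hG : ∀ i, DifferentiableAt ℝ (Gs L i) p := fun i =>
    hL.differentiableAt (hL.contDiffOn_Gs i) hp
  have hG' : ∀ i, DifferentiableAt ℝ (de (Gs L i) j) p := fun i =>
    hL.differentiableAt (hL.contDiffOn_de (hL.contDiffOn_Gs i) j) hp
  have hT : ∀ i, DifferentiableAt ℝ (de (gm L i r) j) p := fun i =>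
    hL.differentiableAt (hL.contDiffOn_de (hL.contDiffOn_gm i r) j) hp
  have hs : DifferentiableAt ℝ (fun q => ∑ k, fib k q * dz (gm L j r) k q) p :=
    .fun_sum fun k _ => (differentiableAt_fib k p).fun_mul (hL.differentiableAt (hd k) hp)
  have h := map_fderiv_congr (eForm m) hL.openD (fun q hq => hL.sum_de_Gs_mul_gm hq j r) hp
  rw [map_fderiv_sum _ (fun i => ((hG i).fun_mul (hT i)).fun_add
      ((hG' i).fun_mul (hL.differentiableAt_gm hp i r))),
    map_fderiv_mul _ (differentiableAt_const _) (hs.fun_add (hL.differentiableAt hd' hp)),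
    fderiv_fun_add hs (hL.differentiableAt hd' hp), map_add,
    map_fderiv_sum_mul _ (differentiableAt_fib · p) fun k => hL.differentiableAt (hd k) hp] at h
  simp only [fderiv_fun_add ((hG _).fun_mul (hT _))
    ((hG' _).fun_mul (hL.differentiableAt_gm hp _ r)), map_add, map_fderiv_mul _ (hG _) (hT _),
    map_fderiv_mul _ (hG' _) (hL.differentiableAt_gm hp _ r), ← de_eq,
    hL.de_dz_comm (hL.contDiffOn_gm _ r) hp,
    hL.de_dz_comm (hL.contDiffOn_debar hL.smooth r) hp, de_fib, ite_mul, one_mul,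
    zero_mul, Finset.sum_add_distrib, Finset.sum_ite_eq', Finset.mem_univ, if_true,
    fderiv_fun_const, Pi.zero_apply, map_zero, add_zero] at h
  have hsymm : ∀ i, de (de (gm L i r) j) m p = de (de (gm L j r) m) i p := fun i =>
    (map_fderiv_congr (eForm m) hL.openD (fun q hq => hL.de_gm_symm hq i r j) hp).trans
      (hL.de_comm (hL.contDiffOn_gm j r) hp i m)
  simp only [hsymm, hL.de_gm_symm hp _ r j] at h
  change _ = 1 / 2 * (_ + dz (gm L m r) j p) at h
  rw [sprayForm_fderiv]
  linear_combination 2 * h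

/-- The metric is complex Landsberg iff `∂g_{j r̄}/∂η^k` is parallel along the spray with respect
to the Berwald connection. -/
theorem isLandsberg_iff (hL : IsCFM n D L) :
    IsLandsberg L D ↔ ∀ p ∈ D, ∀ j k r, sprayForm L p (fderiv ℝ (de (gm L j r) k) p) =
      ∑ i, de (Gs L i) k p * de (gm L j r) i p + ∑ i, de (Gs L i) j p * de (gm L i r) k p := by
  refine forall₂_congr fun p hp => ?_
  have key : ∀ j k r, (∑ i, de (de (Gs L i) k) j p * gm L i r p =
      ∑ i, ((1 / 2) * ∑ l, gi L l i p * (delc L (gm L j l) k p + delc L (gm L k l) j p)) *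
        gm L i r p) ↔ sprayForm L p (fderiv ℝ (de (gm L j r) k) p) =
      ∑ i, de (Gs L i) k p * de (gm L j r) i p + ∑ i, de (Gs L i) j p * de (gm L i r) k p := by
    intro j k r
    have h := hL.sum_de_de_Gs_mul_gm hp j k r
    simp only [hL.de_comm (hL.contDiffOn_Gs _) hp k j, mul_assoc, ← Finset.mul_sum]
    rw [hL.sum_raise_mul_gm hp (fun l => delc L (gm L j l) k p + delc L (gm L k l) j p) r]
    simp only [delc, hL.de_gm_symm hp k r]
    constructor <;> intro h'
    · linear_combination 2 * h' - h
    · linear_combination h / 2 + h' / 2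
  constructor
  · intro h j k r
    exact (key j k r).1 (Finset.sum_congr rfl fun i _ => by rw [h i j k])
  · intro h i j k
    exact hL.lower_injective hp (a := fun i => de (de (Gs L i) k) j p)
      (b := fun i => (1 / 2) * ∑ l, gi L l i p * (delc L (gm L j l) k p + delc L (gm L k l) j p))
      (fun r => (key j k r).2 (h j k r)) i

end IsCFM

theorem eq_zero_of_two_contractions {u m v : Fin 2 → ℂ} (hd : u 0 * m 1 - u 1 * m 0 ≠ 0)
    (hu : ∑ i, u i * v i = 0) (hm : ∑ i, m i * v i = 0) (i : Fin 2) : v i = 0 := by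
  rw [Fin.sum_univ_two] at hu hm
  refine (mul_eq_zero.1 ?_).resolve_left hd
  fin_cases i
  · change (u 0 * m 1 - u 1 * m 0) * v 0 = 0
    linear_combination m 1 * hu - u 1 * hm
  · change (u 0 * m 1 - u 1 * m 0) * v 1 = 0
    linear_combination u 0 * hm - m 0 * hu

theorem contDiffOn_div {E : Type*} [NormedAddCommGroup E] [NormedSpace ℝ E] {D : Set E}
    {f g : E → ℂ} (hf : ContDiffOn ℝ (⊤ : ℕ∞) f D) (hg : ContDiffOn ℝ (⊤ : ℕ∞) g D)
    (h : ∀ q ∈ D, g q ≠ 0) : ContDiffOn ℝ (⊤ : ℕ∞) (fun q => f q / g q) D := by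
  simp only [div_eq_mul_inv]
  exact hf.mul (hg.inv h)

namespace IsCFM

section Frame

variable {D : Set (Pt 2)} {L : Pt 2 → ℂ} {p : Pt 2}

theorem det_im (hL : IsCFM 2 D L) (hp : p ∈ D) : (gmat L p).det.im = 0 := by
  rw [← conj_eq_iff_im, Matrix.det_fin_two]
  simp only [gmat, map_sub, map_mul, hL.hermitian p hp]
  ring

theorem det_re_pos (hL : IsCFM 2 D L) (hp : p ∈ D) : 0 < (gmat L p).det.re := by
  have h00 : 0 < (gm L 0 0 p).re := by
    have h := hL.posdef p hp ![1, 0] fun h => one_ne_zero (congrFun h 0)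
    simpa [Fin.sum_univ_two] using h
  have him : (gm L 0 0 p).im = 0 := conj_eq_iff_im.1 (hL.hermitian p hp 0 0)
  have hne : gm L 0 0 p ≠ 0 := fun h => by simp [h] at h00
  have h := hL.posdef p hp ![gm L 1 0 p, -gm L 0 0 p] fun h => hne (by simpa using congrFun h 1)
  have e : ∑ i, ∑ j, gm L i j p * ![gm L 1 0 p, -gm L 0 0 p] i *
      (starRingEnd ℂ) (![gm L 1 0 p, -gm L 0 0 p] j) = gm L 0 0 p * (gmat L p).det := by
    simp only [Fin.sum_univ_two, Matrix.det_fin_two, gmat, Matrix.cons_val_zero,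
      Matrix.cons_val_one, map_neg, hL.hermitian p hp]
    ring
  rw [e, mul_re, him, zero_mul, sub_zero] at h
  exact (pos_iff_pos_of_mul_pos h).1 h00

theorem sg_mul_self (hL : IsCFM 2 D L) (hp : p ∈ D) : sg L p * sg L p = (gmat L p).det := by
  rw [sg, ← ofReal_mul, Real.mul_self_sqrt (hL.det_re_pos hp).le]
  exact Complex.ext rfl (hL.det_im hp).symm

theorem sg_ne_zero (hL : IsCFM 2 D L) (hp : p ∈ D) : sg L p ≠ 0 :=
  ofReal_ne_zero.2 (Real.sqrt_ne_zero'.2 (hL.det_re_pos hp))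

theorem Fh_mul_self (hL : IsCFM 2 D L) (hp : p ∈ D) : Fh L p * Fh L p = L p := by
  rw [Fh, ← ofReal_mul, Real.mul_self_sqrt (hL.pos p hp).le]
  exact Complex.ext rfl (hL.real_im p hp).symm

theorem Fh_ne_zero (hL : IsCFM 2 D L) (hp : p ∈ D) : Fh L p ≠ 0 :=
  ofReal_ne_zero.2 (Real.sqrt_ne_zero'.2 (hL.pos p hp))

theorem contDiffOn_ofReal_sqrt_re {f : Pt 2 → ℂ} (hf : ContDiffOn ℝ (⊤ : ℕ∞) f D)
    (hpos : ∀ q ∈ D, 0 < (f q).re) :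
    ContDiffOn ℝ (⊤ : ℕ∞) (fun q => (Real.sqrt (f q).re : ℂ)) D :=
  ofRealCLM.contDiff.comp_contDiffOn
    ((reCLM.contDiff.comp_contDiffOn hf).sqrt fun q hq => (hpos q hq).ne')

theorem contDiffOn_Fh (hL : IsCFM 2 D L) : ContDiffOn ℝ (⊤ : ℕ∞) (Fh L) D :=
  contDiffOn_ofReal_sqrt_re hL.smooth hL.pos

theorem contDiffOn_sg (hL : IsCFM 2 D L) : ContDiffOn ℝ (⊤ : ℕ∞) (sg L) D :=
  contDiffOn_ofReal_sqrt_re (contDiffOn_det (M := gmat L) fun i j => hL.contDiffOn_gm i j)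
    fun _ hq => hL.det_re_pos hq

theorem contDiffOn_llow (hL : IsCFM 2 D L) (i : Fin 2) : ContDiffOn ℝ (⊤ : ℕ∞) (llow L i) D :=
  contDiffOn_div (ContDiffOn.sum fun j _ => (hL.contDiffOn_gm i j).mul
    (contDiff_fibbar j).contDiffOn) hL.contDiffOn_Fh fun _ hq => hL.Fh_ne_zero hq

theorem contDiffOn_mup (hL : IsCFM 2 D L) (i : Fin 2) : ContDiffOn ℝ (⊤ : ℕ∞) (mup L i) D := by
  unfold mup
  split_ifs
  · exact contDiffOn_div (hL.contDiffOn_llow 1).neg hL.contDiffOn_sg fun _ hq => hL.sg_ne_zero hq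
  · exact contDiffOn_div (hL.contDiffOn_llow 0) hL.contDiffOn_sg fun _ hq => hL.sg_ne_zero hq

theorem llow_mul_Fh (hL : IsCFM 2 D L) (hp : p ∈ D) (i : Fin 2) :
    llow L i p * Fh L p = ∑ j, gm L i j p * fibbar j p :=
  div_mul_cancel₀ _ (hL.Fh_ne_zero hp)

theorem lup_mul_Fh (hL : IsCFM 2 D L) (hp : p ∈ D) (i : Fin 2) :
    lup L i p * Fh L p = p.2 i :=
  div_mul_cancel₀ _ (hL.Fh_ne_zero hp)

theorem mup_zero_mul_sg (hL : IsCFM 2 D L) (hp : p ∈ D) :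
    mup L 0 p * sg L p = -llow L 1 p := by
  rw [mup, if_pos rfl, div_mul_cancel₀ _ (hL.sg_ne_zero hp)]

theorem mup_one_mul_sg (hL : IsCFM 2 D L) (hp : p ∈ D) :
    mup L 1 p * sg L p = llow L 0 p := by
  rw [mup, if_neg one_ne_zero, div_mul_cancel₀ _ (hL.sg_ne_zero hp)]

theorem conj_Fh : (starRingEnd ℂ) (Fh L p) = Fh L p := conj_ofReal _

theorem conj_sg : (starRingEnd ℂ) (sg L p) = sg L p := conj_ofReal _

theorem conj_llow_mul_Fh (hL : IsCFM 2 D L) (hp : p ∈ D) (i : Fin 2) :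
    (starRingEnd ℂ) (llow L i p) * Fh L p = debar L i p := by
  rw [← conj_Fh, ← map_mul, hL.llow_mul_Fh hp, ← hL.sum_fib_mul_gm hp, map_sum]
  exact Finset.sum_congr rfl fun j _ => by
    rw [map_mul, hL.hermitian p hp, fibbar, conj_conj, mul_comm, fib]

theorem conj_mup_zero_mul (hL : IsCFM 2 D L) (hp : p ∈ D) :
    (starRingEnd ℂ) (mup L 0 p) * (sg L p * Fh L p) = -debar L 1 p := by
  have h := congrArg (starRingEnd ℂ) (hL.mup_zero_mul_sg hp)
  rw [map_mul, map_neg, conj_sg] at h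
  linear_combination Fh L p * h - hL.conj_llow_mul_Fh hp 1

theorem conj_mup_one_mul (hL : IsCFM 2 D L) (hp : p ∈ D) :
    (starRingEnd ℂ) (mup L 1 p) * (sg L p * Fh L p) = debar L 0 p := by
  have h := congrArg (starRingEnd ℂ) (hL.mup_one_mul_sg hp)
  rw [map_mul, conj_sg] at h
  linear_combination Fh L p * h + hL.conj_llow_mul_Fh hp 0

theorem sum_lup_mul_llow (hL : IsCFM 2 D L) (hp : p ∈ D) :
    lup L 0 p * llow L 0 p + lup L 1 p * llow L 1 p = 1 := by
  have h := (hL.euler hp).1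
  simp only [← hL.sum_fibbar_mul_gm hp, Fin.sum_univ_two] at h
  have h0 := hL.llow_mul_Fh hp 0
  have h1 := hL.llow_mul_Fh hp 1
  rw [Fin.sum_univ_two] at h0 h1
  refine mul_right_cancel₀ (mul_ne_zero (hL.Fh_ne_zero hp) (hL.Fh_ne_zero hp)) ?_
  linear_combination llow L 0 p * Fh L p * hL.lup_mul_Fh hp 0 +
    llow L 1 p * Fh L p * hL.lup_mul_Fh hp 1 + p.2 0 * h0 + p.2 1 * h1 + h - hL.Fh_mul_self hp

theorem mlow_zero (hL : IsCFM 2 D L) (hp : p ∈ D) : mlow L 0 p = -(sg L p * lup L 1 p) := by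
  have e0 := hL.sum_fib_mul_gm hp 0
  have e1 := hL.sum_fib_mul_gm hp 1
  have hs := hL.sg_mul_self hp
  simp only [Fin.sum_univ_two, Matrix.det_fin_two, gmat, fib] at e0 e1 hs
  rw [mlow, Fin.sum_univ_two]
  refine mul_right_cancel₀ (mul_ne_zero (hL.sg_ne_zero hp) (hL.Fh_ne_zero hp)) ?_
  linear_combination gm L 0 0 p * hL.conj_mup_zero_mul hp + gm L 0 1 p * hL.conj_mup_one_mul hp +
    gm L 0 0 p * e1 - gm L 0 1 p * e0 + lup L 1 p * Fh L p * hs +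
    (gm L 0 0 p * gm L 1 1 p - gm L 0 1 p * gm L 1 0 p) * hL.lup_mul_Fh hp 1

theorem mlow_one (hL : IsCFM 2 D L) (hp : p ∈ D) : mlow L 1 p = sg L p * lup L 0 p := by
  have e0 := hL.sum_fib_mul_gm hp 0
  have e1 := hL.sum_fib_mul_gm hp 1
  have hs := hL.sg_mul_self hp
  simp only [Fin.sum_univ_two, Matrix.det_fin_two, gmat, fib] at e0 e1 hs
  rw [mlow, Fin.sum_univ_two]
  refine mul_right_cancel₀ (mul_ne_zero (hL.sg_ne_zero hp) (hL.Fh_ne_zero hp)) ?_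
  linear_combination gm L 1 0 p * hL.conj_mup_zero_mul hp + gm L 1 1 p * hL.conj_mup_one_mul hp +
    gm L 1 0 p * e1 - gm L 1 1 p * e0 - lup L 0 p * Fh L p * hs -
    (gm L 0 0 p * gm L 1 1 p - gm L 0 1 p * gm L 1 0 p) * hL.lup_mul_Fh hp 0

/-- The Berwald frame and its dual resolve the identity. -/
theorem frame_resolution (hL : IsCFM 2 D L) (hp : p ∈ D) (i k : Fin 2) :
    lup L i p * llow L k p + mup L i p * mlow L k p = if i = k then 1 else 0 := by
  have h := hL.sum_lup_mul_llow hp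
  have m0 := hL.mup_zero_mul_sg hp
  have m1 := hL.mup_one_mul_sg hp
  fin_cases i <;> fin_cases k <;>
    simp [hL.mlow_zero hp, hL.mlow_one hp]
  · linear_combination h - lup L 1 p * m0
  · linear_combination lup L 0 p * m0
  · linear_combination -lup L 1 p * m1
  · linear_combination h + lup L 0 p * m1

theorem sum_mul_eq_of_sum_fib (hL : IsCFM 2 D L) (hp : p ∈ D) (v w : Fin 2 → ℂ)
    (hw : ∑ i, fib i p * w i = 0) :
    ∑ i, v i * w i = (∑ k, mlow L k p * v k) * ∑ i, mup L i p * w i := by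
  have hw' : ∑ i, lup L i p * w i = 0 := by
    refine mul_right_cancel₀ (hL.Fh_ne_zero hp) ?_
    rw [zero_mul, ← hw, Finset.sum_mul]
    exact Finset.sum_congr rfl fun i _ => by
      rw [mul_right_comm, hL.lup_mul_Fh hp, fib]
  have h00 := hL.frame_resolution hp 0 0
  have h01 := hL.frame_resolution hp 0 1
  have h10 := hL.frame_resolution hp 1 0
  have h11 := hL.frame_resolution hp 1 1
  simp only [if_true, zero_ne_one, one_ne_zero, if_false] at h00 h01 h10 h11
  simp only [Fin.sum_univ_two] at hw' ⊢
  linear_combination -v 0 * w 0 * h00 - v 1 * w 0 * h01 - v 0 * w 1 * h10 - v 1 * w 1 * h11 +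
    (llow L 0 p * v 0 + llow L 1 p * v 1) * hw'

theorem fib_mup_ne_zero (hL : IsCFM 2 D L) (hp : p ∈ D) :
    fib 0 p * mup L 1 p - fib 1 p * mup L 0 p ≠ 0 := by
  intro h
  refine hL.Fh_ne_zero hp ?_
  rw [fib, fib, ← hL.lup_mul_Fh hp 0, ← hL.lup_mul_Fh hp 1] at h
  linear_combination sg L p * h - Fh L p * hL.sum_lup_mul_llow hp -
    lup L 0 p * Fh L p * hL.mup_one_mul_sg hp + lup L 1 p * Fh L p * hL.mup_zero_mul_sg hp

theorem Fh_mul_sE (hL : IsCFM 2 D L) (hp : p ∈ D) :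
    Fh L p * sE L p = ∑ i, mlow L i p * ∑ k, Nc L i k p * mup L k p := by
  simp only [sE, ← hL.sum_Lc_mul_fib hp, ← hL.lup_mul_Fh hp, Fin.sum_univ_two]
  ring

theorem Fh_mul_sY (hL : IsCFM 2 D L) (hp : p ∈ D) :
    Fh L p * sY L p = ∑ i, mlow L i p * ∑ j, sprayLc L i j p * mup L j p := by
  simp only [sY, sprayLc, ← hL.lup_mul_Fh hp, Fin.sum_univ_two]
  ring

theorem trace_sprayLc (hL : IsCFM 2 D L) (hp : p ∈ D) :
    ∑ i, sprayLc L i i p = Fh L p * (sJ L p + sY L p) := by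
  have hJ : Fh L p * sJ L p = ∑ i, llow L i p * ∑ j, sprayLc L i j p * lup L j p := by
    simp only [sJ, sprayLc, ← hL.lup_mul_Fh hp, Fin.sum_univ_two]
    ring
  have h00 := hL.frame_resolution hp 0 0
  have h01 := hL.frame_resolution hp 0 1
  have h10 := hL.frame_resolution hp 1 0
  have h11 := hL.frame_resolution hp 1 1
  simp only [if_true, zero_ne_one, one_ne_zero, if_false] at h00 h01 h10 h11
  rw [mul_add, hJ, hL.Fh_mul_sY hp]
  simp only [Fin.sum_univ_two]
  linear_combination -sprayLc L 0 0 p * h00 - sprayLc L 1 0 p * h01 - sprayLc L 0 1 p * h10 -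
    sprayLc L 1 1 p * h11

end Frame

end IsCFM

/-- The contraction `m^j m^k ∂g_{j r̄}/∂η^k`. -/
def vertGm (L : Pt 2 → ℂ) (r : Fin 2) (p : Pt 2) : ℂ :=
  ∑ j, mup L j p * ∑ k, mup L k p * de (gm L j r) k p

/-- The Berwald covariant derivative along the spray of `∂g_{j r̄}/∂η^k`. -/
def landsbergTensor (L : Pt n → ℂ) (j k r : Fin n) (p : Pt n) : ℂ :=
  sprayForm L p (fderiv ℝ (de (gm L j r) k) p) -
    (∑ i, de (Gs L i) k p * de (gm L j r) i p + ∑ i, de (Gs L i) j p * de (gm L i r) k p)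

namespace IsCFM

section FrameDerivatives

variable {D : Set (Pt 2)} {L : Pt 2 → ℂ} {p : Pt 2}

theorem contDiffOn_conj_mup (hL : IsCFM 2 D L) (i : Fin 2) :
    ContDiffOn ℝ (⊤ : ℕ∞) (fun q => (starRingEnd ℂ) (mup L i q)) D :=
  conjCLE.contDiff.comp_contDiffOn (hL.contDiffOn_mup i)

theorem sprayForm_Fh (hL : IsCFM 2 D L) (hp : p ∈ D) :
    sprayForm L p (fderiv ℝ (Fh L) p) = 0 := by
  have hF := hL.differentiableAt hL.contDiffOn_Fh hp
  have h := map_fderiv_congr (sprayForm L p) hL.openD (fun q hq => hL.Fh_mul_self hq) hp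
  rw [map_fderiv_mul _ hF hF, hL.sprayForm_self hp] at h
  refine (mul_eq_zero.1 ?_).resolve_left (hL.Fh_ne_zero hp)
  linear_combination h / 2

theorem sprayForm_sg (hL : IsCFM 2 D L) (hp : p ∈ D) :
    sprayForm L p (fderiv ℝ (sg L) p) = (1 / 2) * (∑ i, sprayLc L i i p) * sg L p := by
  have hs := hL.differentiableAt hL.contDiffOn_sg hp
  have hg := hL.differentiableAt_gm hp
  have h := map_fderiv_congr (sprayForm L p) hL.openD
    (g := fun q => gm L 0 0 q * gm L 1 1 q - gm L 0 1 q * gm L 1 0 q)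
    (fun q hq => (hL.sg_mul_self hq).trans (Matrix.det_fin_two _)) hp
  have hdet := hL.sg_mul_self hp
  rw [map_fderiv_mul _ hs hs, fderiv_fun_sub ((hg 0 0).fun_mul (hg 1 1))
    ((hg 0 1).fun_mul (hg 1 0)), map_sub, map_fderiv_mul _ (hg 0 0) (hg 1 1),
    map_fderiv_mul _ (hg 0 1) (hg 1 0)] at h
  simp only [hL.sprayForm_gm hp, Fin.sum_univ_two, Matrix.det_fin_two, gmat] at h hdet ⊢
  refine mul_left_cancel₀ (hL.sg_ne_zero hp) ?_
  linear_combination h / 2 - (sprayLc L 0 0 p + sprayLc L 1 1 p) / 2 * hdet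

theorem sprayForm_llow (hL : IsCFM 2 D L) (hp : p ∈ D) (i : Fin 2) :
    sprayForm L p (fderiv ℝ (llow L i) p) = ∑ h, sprayLc L h i p * llow L h p := by
  have h := map_fderiv_congr (sprayForm L p) hL.openD (fun q hq => hL.llow_mul_Fh hq i) hp
  rw [map_fderiv_mul _ (hL.differentiableAt (hL.contDiffOn_llow i) hp)
    (hL.differentiableAt hL.contDiffOn_Fh hp), hL.sprayForm_Fh hp,
    map_fderiv_sum_mul _ (hL.differentiableAt_gm hp i) (differentiableAt_fibbar · p)] at h
  simp only [hL.sprayForm_gm hp, sprayForm_fibbar, Fin.sum_univ_two] at h ⊢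
  have h0 := hL.llow_mul_Fh hp 0
  have h1 := hL.llow_mul_Fh hp 1
  rw [Fin.sum_univ_two] at h0 h1
  refine mul_right_cancel₀ (hL.Fh_ne_zero hp) ?_
  linear_combination h - sprayLc L 0 i p * h0 - sprayLc L 1 i p * h1

theorem sprayForm_mup (hL : IsCFM 2 D L) (hp : p ∈ D) (j : Fin 2) :
    sprayForm L p (fderiv ℝ (mup L j) p) =
      (1 / 2) * (∑ i, sprayLc L i i p) * mup L j p - ∑ i, sprayLc L j i p * mup L i p := by
  have hm := fun i => hL.differentiableAt (hL.contDiffOn_mup i) hp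
  have hs := hL.differentiableAt hL.contDiffOn_sg hp
  have m0 := hL.mup_zero_mul_sg hp
  have m1 := hL.mup_one_mul_sg hp
  have h0 := map_fderiv_congr (sprayForm L p) hL.openD (g := fun q => -llow L 1 q)
    (fun q hq => hL.mup_zero_mul_sg hq) hp
  have h1 := map_fderiv_congr (sprayForm L p) hL.openD (fun q hq => hL.mup_one_mul_sg hq) hp
  rw [map_fderiv_mul _ (hm _) hs, hL.sprayForm_sg hp] at h0 h1
  rw [fderiv_fun_neg, map_neg, hL.sprayForm_llow hp] at h0
  rw [hL.sprayForm_llow hp] at h1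
  refine mul_right_cancel₀ (hL.sg_ne_zero hp) ?_
  simp only [Fin.sum_univ_two] at h0 h1 ⊢
  obtain rfl | rfl : j = 0 ∨ j = 1 := by fin_cases j <;> simp
  · linear_combination h0 + sprayLc L 0 1 p * m1 - sprayLc L 1 1 p * m0
  · linear_combination h1 + sprayLc L 1 0 p * m0 - sprayLc L 0 0 p * m1

theorem sprayForm_conj_mup (hL : IsCFM 2 D L) (hp : p ∈ D) (j : Fin 2) :
    sprayForm L p (fderiv ℝ (fun q => (starRingEnd ℂ) (mup L j q)) p) =
      -((1 / 2) * (∑ i, sprayLc L i i p) * (starRingEnd ℂ) (mup L j p)) := by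
  have hm := fun i => hL.differentiableAt (hL.contDiffOn_conj_mup i) hp
  have hs := hL.differentiableAt hL.contDiffOn_sg hp
  have hF := hL.differentiableAt hL.contDiffOn_Fh hp
  have h0 := map_fderiv_congr (sprayForm L p) hL.openD (g := fun q => -debar L 1 q)
    (fun q hq => hL.conj_mup_zero_mul hq) hp
  have h1 := map_fderiv_congr (sprayForm L p) hL.openD (fun q hq => hL.conj_mup_one_mul hq) hp
  rw [map_fderiv_mul _ (hm _) (hs.fun_mul hF), map_fderiv_mul _ hs hF, hL.sprayForm_sg hp,
    hL.sprayForm_Fh hp] at h0 h1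
  rw [fderiv_fun_neg, map_neg, hL.sprayForm_debar hp] at h0
  rw [hL.sprayForm_debar hp] at h1
  refine mul_right_cancel₀ (mul_ne_zero (hL.sg_ne_zero hp) (hL.Fh_ne_zero hp)) ?_
  obtain rfl | rfl : j = 0 ∨ j = 1 := by fin_cases j <;> simp
  · linear_combination h0
  · linear_combination h1

end FrameDerivatives

section Landsberg

variable {D : Set (Pt 2)} {L : Pt 2 → ℂ} {p : Pt 2}

theorem contDiffOn_de_gm (hL : IsCFM 2 D L) (j r k : Fin 2) :
    ContDiffOn ℝ (⊤ : ℕ∞) (de (gm L j r) k) D := hL.contDiffOn_de (hL.contDiffOn_gm j r) k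

theorem contDiffOn_vertGm (hL : IsCFM 2 D L) (r : Fin 2) :
    ContDiffOn ℝ (⊤ : ℕ∞) (vertGm L r) D :=
  ContDiffOn.sum fun j _ => (hL.contDiffOn_mup j).mul <| ContDiffOn.sum fun k _ =>
    (hL.contDiffOn_mup k).mul (hL.contDiffOn_de_gm j r k)

theorem sA_mul_Fh (hL : IsCFM 2 D L) (hp : p ∈ D) :
    sA L p * Fh L p = ∑ r, fibbar r p * vertGm L r p := by
  have e : sA L p * Fh L p = ∑ j, ∑ k, ∑ h,
      mup L j p * mup L k p * Cc L h k j p * (llow L h p * Fh L p) := by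
    simp only [sA, Finset.sum_mul]
    exact Finset.sum_congr rfl fun _ _ => Finset.sum_congr rfl fun _ _ =>
      Finset.sum_congr rfl fun _ _ => by ring
  simp only [e, vertGm, ← hL.sum_Cc_mul_gm hp, hL.llow_mul_Fh hp, Fin.sum_univ_two]
  ring

theorem sB_eq (hL : IsCFM 2 D L) (hp : p ∈ D) :
    sB L p = ∑ r, (starRingEnd ℂ) (mup L r p) * vertGm L r p := by
  simp only [sB, mlow, vertGm, ← hL.sum_Cc_mul_gm hp, Fin.sum_univ_two]
  ring

theorem landsbergTensor_symm (hL : IsCFM 2 D L) (hp : p ∈ D) (j k r : Fin 2) :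
    landsbergTensor L j k r p = landsbergTensor L k j r p := by
  rw [landsbergTensor, landsbergTensor, map_fderiv_congr _ hL.openD
    (fun q hq => hL.de_gm_symm hq j r k) hp, add_comm]
  simp only [hL.de_gm_symm hp _ r _]

theorem sum_fib_mul_landsbergTensor (hL : IsCFM 2 D L) (hp : p ∈ D) (k r : Fin 2) :
    ∑ j, fib j p * landsbergTensor L j k r p = 0 := by
  have h := map_fderiv_congr (sprayForm L p) hL.openD (g := fun _ => 0)
    (fun q hq => hL.sum_fib_mul_de_gm hq r k) hp
  rw [map_fderiv_sum_mul _ (differentiableAt_fib · p) fun j =>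
    hL.differentiableAt (hL.contDiffOn_de_gm j r k) hp] at h
  have hfib : ∀ j, sprayForm L p (fderiv ℝ (fib j) p) = -2 * Gs L j p := fun j => by
    simp [sprayForm_fderiv, dz_fib, de_fib]
  have hG : ∀ i, ∑ j, de (Gs L i) j p * fib j p = 2 * Gs L i p := fun i => by
    have hP : ∑ j, sprayLc L i j p * fib j p = ∑ k, Nc L i k p * p.2 k := by
      simp only [sprayLc, ← hL.sum_Lc_mul_fib hp, fib, Fin.sum_univ_two]
      ring
    have hN : ∑ j, (2 * de (Gs L i) j p) * fib j p = 4 * Gs L i p := by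
      simp only [hL.two_mul_de_Gs hp, add_mul, Finset.sum_add_distrib, hP]
      simp only [Gs, fib]
      ring
    simp only [mul_assoc, ← Finset.mul_sum] at hN
    linear_combination hN / 2
  have hT := fun i => hL.sum_fib_mul_de_gm hp r i
  have hT' : ∀ i, fib 0 p * de (gm L 0 r) i p + fib 1 p * de (gm L 1 r) i p = 0 := fun i => by
    simpa using hT i
  have hG' := fun i => (Fin.sum_univ_two _).symm.trans (hG i)
  simp only [hfib, fderiv_fun_const, Pi.zero_apply, map_zero, Fin.sum_univ_two] at h
  simp only [landsbergTensor, Fin.sum_univ_two]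
  linear_combination h - de (Gs L 0) k p * hT' 0 - de (Gs L 1) k p * hT' 1 -
    de (gm L 0 r) k p * hG' 0 - de (gm L 1 r) k p * hG' 1

theorem landsbergTensor_eq_zero_iff (hL : IsCFM 2 D L) (hp : p ∈ D) (r : Fin 2) :
    (∀ j k, landsbergTensor L j k r p = 0) ↔
      ∑ j, mup L j p * ∑ k, mup L k p * landsbergTensor L j k r p = 0 := by
  refine ⟨fun h => by simp [h], fun h => ?_⟩
  have hS : ∀ j, ∑ k, fib k p * landsbergTensor L j k r p = 0 := fun j => by
    simpa only [hL.landsbergTensor_symm hp j] using hL.sum_fib_mul_landsbergTensor hp j r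
  have hv : ∀ j, ∑ k, mup L k p * landsbergTensor L j k r p = 0 := by
    refine eq_zero_of_two_contractions (u := fun i => fib i p) (m := fun i => mup L i p)
      (hL.fib_mup_ne_zero hp) ?_ h
    have h0 := hL.sum_fib_mul_landsbergTensor hp 0 r
    have h1 := hL.sum_fib_mul_landsbergTensor hp 1 r
    simp only [Fin.sum_univ_two] at h0 h1 ⊢
    linear_combination mup L 0 p * h0 + mup L 1 p * h1
  exact fun j => eq_zero_of_two_contractions (u := fun i => fib i p) (m := fun i => mup L i p)
    (hL.fib_mup_ne_zero hp) (hS j) (hv j)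

theorem sprayForm_vertGm (hL : IsCFM 2 D L) (hp : p ∈ D) (r : Fin 2) :
    sprayForm L p (fderiv ℝ (vertGm L r) p) =
      ∑ j, mup L j p * ∑ k, mup L k p * landsbergTensor L j k r p +
        Fh L p * (sJ L p + sE L p) * vertGm L r p := by
  have hm := fun i => hL.differentiableAt (hL.contDiffOn_mup i) hp
  have hT := fun j k => hL.differentiableAt (hL.contDiffOn_de_gm j r k) hp
  have hw : ∑ i, fib i p * ∑ k, mup L k p * de (gm L i r) k p = 0 := by
    have h0 := hL.sum_fib_mul_de_gm hp r 0
    have h1 := hL.sum_fib_mul_de_gm hp r 1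
    simp only [Fin.sum_univ_two] at h0 h1 ⊢
    linear_combination mup L 0 p * h0 + mup L 1 p * h1
  have hE := hL.sum_mul_eq_of_sum_fib hp (fun i => ∑ k, Nc L i k p * mup L k p) _ hw
  have hY := hL.sum_mul_eq_of_sum_fib hp (fun i => ∑ k, sprayLc L i k p * mup L k p) _ hw
  rw [← hL.Fh_mul_sE hp] at hE
  rw [← hL.Fh_mul_sY hp] at hY
  have htr := hL.trace_sprayLc hp
  unfold vertGm
  rw [map_fderiv_sum_mul _ hm fun j => .fun_sum fun k _ => (hm k).fun_mul (hT j k)]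
  simp only [map_fderiv_sum_mul _ hm (hT _), hL.sprayForm_mup hp, htr]
  have hG : ∀ i j, de (Gs L i) j p = (1 / 2) * (sprayLc L i j p + Nc L i j p) := fun i j => by
    rw [← hL.two_mul_de_Gs hp]
    ring
  have hs : de (gm L 1 r) 0 p = de (gm L 0 r) 1 p := hL.de_gm_symm hp 1 r 0
  simp only [landsbergTensor, hG, Fin.sum_univ_two, hs] at hE hY ⊢
  linear_combination hE - hY

/-- At a point the two scalar conditions say that the spray derivative of `vertGm` is
`F (J + E)` times `vertGm`. -/
theorem frame_conditions_iff (hL : IsCFM 2 D L) (hp : p ∈ D) :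
    (Fh L p * sA L p * (sE L p - sY L p) =
        (∑ k, del L (sA L) k p * p.2 k) - Fh L p * sA L p * (sJ L p + sY L p) ∧
      Fh L p * sB L p * (sE L p - sY L p) =
        (∑ k, del L (sB L) k p * p.2 k) - Fh L p * sB L p / 2 * (sJ L p + sY L p)) ↔
    ∀ r, sprayForm L p (fderiv ℝ (vertGm L r) p) =
      Fh L p * (sJ L p + sE L p) * vertGm L r p := by
  have hv := fun r => hL.differentiableAt (hL.contDiffOn_vertGm r) hp
  have hm := fun i => hL.differentiableAt (hL.contDiffOn_conj_mup i) hp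
  have hF := hL.differentiableAt hL.contDiffOn_Fh hp
  have hAd : DifferentiableAt ℝ (sA L) p := by
    refine hL.differentiableAt ((contDiffOn_div (f := fun q => ∑ r, fibbar r q * vertGm L r q)
      (ContDiffOn.sum fun r _ => (contDiff_fibbar r).contDiffOn.mul (hL.contDiffOn_vertGm r))
      hL.contDiffOn_Fh fun _ hq => hL.Fh_ne_zero hq).congr fun q hq => ?_) hp
    rw [← hL.sA_mul_Fh hq, mul_div_cancel_right₀ _ (hL.Fh_ne_zero hq)]
  have hA := map_fderiv_congr (sprayForm L p) hL.openD (fun q hq => hL.sA_mul_Fh hq) hp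
  rw [map_fderiv_mul _ hAd hF, hL.sprayForm_Fh hp,
    map_fderiv_sum_mul _ (differentiableAt_fibbar · p) hv] at hA
  have hB := map_fderiv_congr (sprayForm L p) hL.openD (fun q hq => hL.sB_eq hq) hp
  rw [map_fderiv_sum_mul _ hm hv] at hB
  simp only [hL.sprayForm_conj_mup hp, hL.trace_sprayLc hp, sprayForm_fibbar] at hA hB
  have hA0 := hL.sA_mul_Fh hp
  have hB0 := hL.sB_eq hp
  rw [sum_del_mul, sum_del_mul]
  have hne : fibbar 0 p * (starRingEnd ℂ) (mup L 1 p) -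
      fibbar 1 p * (starRingEnd ℂ) (mup L 0 p) ≠ 0 := fun h => by
    refine hL.fib_mup_ne_zero hp ((map_eq_zero (starRingEnd ℂ)).1 ?_)
    rw [map_sub, map_mul, map_mul]
    exact h
  simp only [Fin.sum_univ_two] at hA hB hA0 hB0
  constructor
  · rintro ⟨h1, h2⟩ r
    refine sub_eq_zero.1 (eq_zero_of_two_contractions (u := fun r => fibbar r p)
      (m := fun r => (starRingEnd ℂ) (mup L r p)) (v := fun r =>
      sprayForm L p (fderiv ℝ (vertGm L r) p) - Fh L p * (sJ L p + sE L p) * vertGm L r p)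
      hne ?_ ?_ r)
    · rw [Fin.sum_univ_two]
      linear_combination -hA - Fh L p * h1 + Fh L p * (sJ L p + sE L p) * hA0
    · rw [Fin.sum_univ_two]
      linear_combination -hB - h2 + Fh L p * (sJ L p + sE L p) * hB0 -
        Fh L p * (sJ L p + sY L p) / 2 * hB0
  · intro h
    constructor
    · refine mul_right_cancel₀ (hL.Fh_ne_zero hp) ?_
      linear_combination -hA - fibbar 0 p * h 0 - fibbar 1 p * h 1 +
        Fh L p * (sJ L p + sE L p) * hA0
    · linear_combination -hB - (starRingEnd ℂ) (mup L 0 p) * h 0 -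
        (starRingEnd ℂ) (mup L 1 p) * h 1 + Fh L p * (sJ L p + sE L p) * hB0 -
        Fh L p * (sJ L p + sY L p) / 2 * hB0

end Landsberg

end IsCFM

/-- Landsberg iff `F A (E−Y) = δ_k(A) η^k − F A (J+Y)` and
`F B (E−Y) = δ_k(B) η^k − (F B/2)(J+Y)`. -/
theorem statement10 (D : Set (Pt 2)) (L : Pt 2 → ℂ) (hL : IsCFM 2 D L) :
    IsLandsberg L D ↔
      ∀ p ∈ D,
        Fh L p * sA L p * (sE L p - sY L p) =
          (∑ k, del L (sA L) k p * p.2 k) - Fh L p * sA L p * (sJ L p + sY L p) ∧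
        Fh L p * sB L p * (sE L p - sY L p) =
          (∑ k, del L (sB L) k p * p.2 k) - Fh L p * sB L p / 2 * (sJ L p + sY L p) := by
  rw [hL.isLandsberg_iff]
  refine forall₂_congr fun p hp => ?_
  rw [hL.frame_conditions_iff hp]
  have h : ∀ r, (sprayForm L p (fderiv ℝ (vertGm L r) p) =
      Fh L p * (sJ L p + sE L p) * vertGm L r p) ↔
      ∀ j k, landsbergTensor L j k r p = 0 := fun r => by
    rw [hL.sprayForm_vertGm hp, add_eq_right, hL.landsbergTensor_eq_zero_iff hp]
  simp only [h, landsbergTensor, sub_eq_zero]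
  exact ⟨fun h r j k => h j k r, fun h j k r => h r j k⟩

end CFinsler
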